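/- Let Ω = Ω_{π/2} be the quarter-plane sector, let φ ∈ C_0^∞(ℝ²) be real-valued, and let 1_+ and 1_− denote the orthogonal projections in L²(ℝ) onto L²(ℝ_+) and L²(ℝ_−) respectively. Then both operators 1_± Op^w(1_Ω φ) 1_± belong to S_{1,∞}, i.e. their singular values are O(k^{−1}). -/

import Mathlib

open MeasureTheory Filter Complex
open scoped ENNReal InnerProductSpace RealInnerProductSpace

noncomputable section

/-- `λ_{k+1}^{(+)}(A)` via the Courant–Fischer min-max principle: for a compact self-adjoint
operator this gives the `(k+1)`-st positive eigenvalue in non-increasing order counting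
multiplicity (and `0` once the positive eigenvalues are exhausted). -/
def eigPlus {H : Type*} [NormedAddCommGroup H] [InnerProductSpace ℂ H]
    (A : H →L[ℂ] H) (k : ℕ) : ℝ :=
  ⨅ V : {V : Submodule ℂ H // Module.rank ℂ V ≤ (k : Cardinal)},
    ⨆ u : {u : H // u ∈ (V : Submodule ℂ H)ᗮ ∧ ‖u‖ = 1},
      (⟪A u.1, u.1⟫_ℂ).re

/-- `λ_{k+1}^{(-)}(A)`, the `(k+1)`-st negative eigenvalue sequence member (absolute value). -/
def eigMinus {H : Type*} [NormedAddCommGroup H] [InnerProductSpace ℂ H]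
    (A : H →L[ℂ] H) (k : ℕ) : ℝ :=
  eigPlus (-A) k

/-- the argument of a complex number, taken in `[0, 2π)` -/
def arg2pi (z : ℂ) : ℝ := if 0 ≤ z.arg then z.arg else z.arg + 2 * Real.pi

/-- the open sector `Ω_θ = {(x,ξ) : 0 < arg (x + iξ) < θ}` in the phase plane -/
def sector (θ : ℝ) : Set (ℝ × ℝ) :=
  {p | 0 < arg2pi (p.1 + p.2 * Complex.I) ∧ arg2pi (p.1 + p.2 * Complex.I) < θ}

abbrev L2R := MeasureTheory.Lp ℂ 2 (volume : Measure ℝ)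

/-- the Weyl quantization integral formula in dimension one -/
def weylIntegral (a : ℝ × ℝ → ℂ) (u : ℝ → ℂ) (x : ℝ) : ℂ :=
  (2 * Real.pi : ℝ)⁻¹ *
    ∫ ξ : ℝ, ∫ y : ℝ,
      Complex.exp (Complex.I * ((x - y) * ξ : ℝ)) * a ((x + y) / 2, ξ) * u y

/-- `T` is the Weyl pseudodifferential operator `Op^w(a)` on `L²(ℝ)` -/
def IsWeylOp (a : ℝ × ℝ → ℂ) (T : L2R →L[ℂ] L2R) : Prop :=
  ∀ u : SchwartzMap ℝ ℂ, ∀ f : L2R, (⇑f =ᵐ[volume] ⇑u) →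
    ⇑(T f) =ᵐ[volume] weylIntegral a ⇑u

/-- the symbol `1_Ω φ` of the operator `A_Ω[φ]` -/
def symbAOm (Ω : Set (ℝ × ℝ)) (φ : ℝ × ℝ → ℝ) : ℝ × ℝ → ℂ :=
  Set.indicator Ω fun τ => (φ τ : ℂ)

/-- approximation numbers = singular values -/
def sVal {H : Type*} [NormedAddCommGroup H] [NormedSpace ℂ H]
    (A : H →L[ℂ] H) (k : ℕ) : ℝ :=
  sInf ((fun F : H →L[ℂ] H => ‖A - F‖) ''
    {F | Module.rank ℂ (LinearMap.range (F : H →ₗ[ℂ] H)) ≤ (k : Cardinal)})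

lemma mem_sector_pi_div_two (p : ℝ × ℝ) : p ∈ sector (Real.pi / 2) ↔ 0 < p.1 ∧ 0 < p.2 := by
  have hre : ((p.1 : ℂ) + p.2 * Complex.I).re = p.1 := by simp
  have him : ((p.1 : ℂ) + p.2 * Complex.I).im = p.2 := by simp
  simp only [sector, Set.mem_ofPred_eq, arg2pi]
  set z : ℂ := (p.1 : ℂ) + p.2 * Complex.I
  rw [← hre, ← him]
  split_ifs with h
  · rw [Complex.arg_lt_pi_div_two_iff]
    have h' := Complex.arg_nonneg_iff.1 h
    constructor
    · rintro ⟨h0, h1⟩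
      have hz : z ≠ 0 := by
        rintro hz
        simp [hz] at h0
      have h2 : 0 < z.re := by
        rcases h1 with h1 | h1 | h1
        · exact h1
        · linarith
        · exact absurd h1 hz
      refine ⟨h2, lt_of_le_of_ne h' fun h3 => ?_⟩
      exact h0.ne' (Complex.arg_eq_zero_iff.2 ⟨h2.le, h3.symm⟩)
    · rintro ⟨h1, h2⟩
      refine ⟨lt_of_le_of_ne h fun h3 => ?_, Or.inl h1⟩
      exact h2.ne' (Complex.arg_eq_zero_iff.1 h3.symm).2
  · rw [Complex.arg_nonneg_iff] at h
    have := Complex.neg_pi_lt_arg z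
    constructor
    · rintro ⟨-, h1⟩
      constructor <;> linarith [Real.pi_pos]
    · rintro ⟨-, h1⟩
      exact absurd h1.le h

lemma symbAOm_quarter_plane (φ : ℝ × ℝ → ℝ) (p : ℝ × ℝ) :
    symbAOm (sector (Real.pi / 2)) φ p = if 0 < p.1 ∧ 0 < p.2 then (φ p : ℂ) else 0 := by
  classical
  simp only [symbAOm, Set.indicator_apply, mem_sector_pi_div_two]

/-- The integrand of the kernel of the Weyl quantization of `φ`. -/
def weylPhase (φ : ℝ × ℝ → ℝ) (x y ξ : ℝ) : ℂ :=
  Complex.exp (Complex.I * ((x - y) * ξ : ℝ)) * φ ((x + y) / 2, ξ)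

/-- The kernel of the Weyl quantization of `φ`, cut off to the frequencies `(0, M]`. -/
def weylKernel (φ : ℝ × ℝ → ℝ) (M x y : ℝ) : ℂ :=
  (2 * Real.pi : ℝ)⁻¹ * ∫ ξ in Set.Ioc 0 M, weylPhase φ x y ξ

lemma continuous_weylPhase {φ : ℝ × ℝ → ℝ} (hφ : Continuous φ) (x : ℝ) :
    Continuous fun p : ℝ × ℝ => weylPhase φ x p.2 p.1 := by
  unfold weylPhase
  fun_prop

lemma norm_exp_I_mul_sub_exp_I_mul_le (s t : ℝ) :
    ‖Complex.exp (Complex.I * s) - Complex.exp (Complex.I * t)‖ ≤ |s - t| := by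
  have h : Complex.exp (Complex.I * s) - Complex.exp (Complex.I * t) =
      Complex.exp (Complex.I * t) * (Complex.exp (Complex.I * (s - t : ℝ)) - 1) := by
    rw [mul_sub, ← Complex.exp_add, mul_one]
    congr 2
    push_cast
    ring
  rw [h, norm_mul, mul_comm Complex.I (t : ℂ), Complex.norm_exp_ofReal_mul_I, one_mul]
  simpa using Real.norm_exp_I_mul_ofReal_sub_one_le (x := s - t)

lemma exists_weylKernel_lipschitz {φ : ℝ × ℝ → ℝ} (hφ : ContDiff ℝ (⊤ : ℕ∞) φ)
    (hc : HasCompactSupport φ) {M : ℝ} (hM : 0 ≤ M) :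
    ∃ C : ℝ, 0 ≤ C ∧ ∀ x y x' y' : ℝ,
      ‖weylKernel φ M x y - weylKernel φ M x' y'‖ ≤ C * (|x - x'| + |y - y'|) := by
  obtain ⟨K, hK⟩ := hφ.lipschitzWith_of_hasCompactSupport hc (by simp)
  obtain ⟨B, hB⟩ := hc.exists_bound_of_continuous hφ.continuous
  have hB0 : 0 ≤ B := (norm_nonneg _).trans (hB 0)
  refine ⟨|(2 * Real.pi)⁻¹| * ((M * B + K) * M), by positivity, fun x y x' y' => ?_⟩
  set d := |x - x'| + |y - y'| with hd
  have hd0 : 0 ≤ d := by positivity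
  have hi : ∀ x y, IntegrableOn (weylPhase φ x y) (Set.Ioc 0 M) := fun x y =>
    (((continuous_weylPhase hφ.continuous x).comp
      (Continuous.prodMk continuous_id (continuous_const (y := y)))).continuousOn.integrableOn_Icc
        (a := 0) (b := M)).mono_set Set.Ioc_subset_Icc_self
  unfold weylKernel
  rw [← mul_sub, ← integral_sub (hi x y) (hi x' y'), norm_mul, mul_assoc]
  rw [Complex.norm_real, Real.norm_eq_abs, mul_assoc]
  refine mul_le_mul_of_nonneg_left ?_ (abs_nonneg _)
  refine (norm_setIntegral_le_of_norm_le_const (C := (M * B + K) * d) (by simp) ?_).trans ?_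
  · intro ξ hξ
    have h1 : weylPhase φ x y ξ - weylPhase φ x' y' ξ =
        (Complex.exp (Complex.I * ((x - y) * ξ : ℝ)) -
          Complex.exp (Complex.I * ((x' - y') * ξ : ℝ))) * φ ((x + y) / 2, ξ) +
        Complex.exp (Complex.I * ((x' - y') * ξ : ℝ)) *
          ((φ ((x + y) / 2, ξ) - φ ((x' + y') / 2, ξ) : ℝ) : ℂ) := by
      unfold weylPhase
      push_cast
      ring
    rw [h1, add_mul]
    refine (norm_add_le _ _).trans (add_le_add ?_ ?_)
    · rw [norm_mul, Complex.norm_real, mul_right_comm]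
      refine mul_le_mul ?_ (hB _) (norm_nonneg _) (by positivity)
      refine (norm_exp_I_mul_sub_exp_I_mul_le _ _).trans ?_
      rw [← sub_mul, abs_mul, abs_of_pos hξ.1, mul_comm]
      refine mul_le_mul hξ.2 ?_ (abs_nonneg _) hM
      calc |x - y - (x' - y')| = |(x - x') - (y - y')| := by ring_nf
        _ ≤ d := abs_sub _ _
    · rw [norm_mul, mul_comm Complex.I, Complex.norm_exp_ofReal_mul_I, one_mul, Complex.norm_real,
        ← dist_eq_norm]
      refine (hK.dist_le_mul _ _).trans (mul_le_mul_of_nonneg_left ?_ K.2)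
      rw [Prod.dist_eq]
      simp only [dist_self, Real.dist_eq]
      refine max_le ?_ hd0
      calc |(x + y) / 2 - (x' + y') / 2| = |(x - x') + (y - y')| / 2 := by
            rw [← abs_two (α := ℝ), ← abs_div, abs_two]; ring_nf
        _ ≤ d / 2 := by gcongr; exact abs_add_le _ _
        _ ≤ d := by linarith
  · simp [Real.volume_real_Ioc_of_le hM]
    apply le_of_eq
    ring

/-- The element of `L²(ℝ)` representing integration over `(a, b]` against `h`. -/
lemma exists_inner_eq_integral_Ioc {h : ℝ → ℂ} (hh : Continuous h) (a b : ℝ) :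
    ∃ g : L2R, (⇑g =ᵐ[volume] (Set.Ioc a b).indicator fun y => starRingEnd ℂ (h y)) ∧
      ∀ f : L2R, ⟪g, f⟫_ℂ = ∫ y, (Set.Ioc a b).indicator h y * f y := by
  have hm : MemLp ((Set.Ioc a b).indicator fun y => starRingEnd ℂ (h y)) 2 volume := by
    rw [memLp_indicator_iff_restrict measurableSet_Ioc]
    obtain ⟨C, hC⟩ := (isCompact_Icc (a := a) (b := b)).exists_bound_of_continuousOn
      hh.continuousOn
    refine MemLp.of_bound (Complex.continuous_conj.comp hh).aestronglyMeasurable C ?_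
    filter_upwards [ae_restrict_mem measurableSet_Ioc] with y hy
    simpa using hC y (Set.Ioc_subset_Icc_self hy)
  refine ⟨hm.toLp, hm.coeFn_toLp, fun f => ?_⟩
  rw [L2.inner_def]
  refine integral_congr_ae ?_
  filter_upwards [hm.coeFn_toLp] with y hy
  rw [hy]
  by_cases h1 : y ∈ Set.Ioc a b <;> simp [h1, mul_comm]

lemma norm_le_of_ae_le_indicator_Ioc {f : L2R} {c a b : ℝ} (hc : 0 ≤ c) (hab : a ≤ b)
    (hf : ∀ᵐ x, ‖f x‖ ≤ (Set.Ioc a b).indicator (fun _ => c) x) :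
    ‖f‖ ≤ c * √(b - a) := by
  have h := norm_indicatorConstLp (p := 2) (μ := (volume : Measure ℝ)) (c := c)
    (hs := measurableSet_Ioc (a := a) (b := b)) (hμs := by simp) (by simp) (by simp)
  rw [Real.volume_real_Ioc_of_le hab, Real.norm_of_nonneg hc] at h
  have h2 : √(b - a) = (b - a) ^ (1 / (2 : ℝ≥0∞).toReal) := by
    rw [Real.sqrt_eq_rpow, ENNReal.toReal_ofNat]
  rw [h2, ← h]
  refine Lp.norm_le_norm_of_ae_le ?_
  filter_upwards [hf, indicatorConstLp_coeFn (p := 2) (μ := (volume : Measure ℝ)) (c := c)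
    (hs := measurableSet_Ioc (a := a) (b := b)) (hμs := by simp)] with x h1 h2
  rw [h2]
  refine h1.trans (le_abs_self _)

lemma sVal_le_of_norm_sub_le {H : Type*} [NormedAddCommGroup H] [NormedSpace ℂ H]
    {A F : H →L[ℂ] H} {k : ℕ} {c : ℝ}
    (hF : Module.rank ℂ (LinearMap.range (F : H →ₗ[ℂ] H)) ≤ (k : Cardinal))
    (h : ‖A - F‖ ≤ c) : sVal A k ≤ c := by
  refine (csInf_le (a := ‖A - F‖) ⟨0, ?_⟩ ?_).trans h
  swap
  · exact (Set.mem_image _ _ _).2 ⟨F, hF, rfl⟩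
  rintro _ ⟨G, -, rfl⟩
  exact norm_nonneg _

lemma rank_range_sum_smulRight_le {H : Type*} [NormedAddCommGroup H] [NormedSpace ℂ H]
    (l : ℕ → H →L[ℂ] ℂ) (e : ℕ → H) (k : ℕ) :
    Module.rank ℂ (LinearMap.range
      ((∑ i ∈ Finset.range k, (l i).smulRight (e i) : H →L[ℂ] H) : H →ₗ[ℂ] H)) ≤ k := by
  classical
  have h : LinearMap.range
      ((∑ i ∈ Finset.range k, (l i).smulRight (e i) : H →L[ℂ] H) : H →ₗ[ℂ] H) ≤
      Submodule.span ℂ (((Finset.range k).image e : Finset H) : Set H) := by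
    rintro _ ⟨f, rfl⟩
    simp only [ContinuousLinearMap.coe_coe, sum_apply,
      ContinuousLinearMap.smulRight_apply]
    refine Submodule.sum_mem _ fun i hi => Submodule.smul_mem _ _ (Submodule.subset_span ?_)
    exact Finset.mem_coe.2 (Finset.mem_image_of_mem e hi)
  refine (Submodule.rank_mono h).trans ((rank_span_finset_le _).trans ?_)
  exact_mod_cast Finset.card_image_le.trans (Finset.card_range k).le

lemma coeFn_sum_L2R (F : ℕ → L2R) (n : ℕ) :
    ⇑(∑ i ∈ Finset.range n, F i) =ᵐ[volume] fun x => ∑ i ∈ Finset.range n, F i x := by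
  induction n with
  | zero =>
    filter_upwards [Lp.coeFn_zero ℂ 2 (volume : Measure ℝ)] with x hx
    simp
  | succ n ih =>
    rw [Finset.sum_range_succ]
    filter_upwards [ih, Lp.coeFn_add (∑ i ∈ Finset.range n, F i) (F n)] with x h1 h2
    rw [h2, Pi.add_apply, h1, Finset.sum_range_succ]

/-- An operator on `L²(ℝ)` acting as `f ↦ ⟪g x, f⟫` on `(0, L]`, with `g` Lipschitz, has
approximation numbers `O(k⁻¹)`. -/
lemma sVal_le_of_lipschitz_inner {A : L2R →L[ℂ] L2R} {g : ℝ → L2R} {L C : ℝ}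
    (hL : 0 < L) (hC : 0 ≤ C) (hg : ∀ x x', ‖g x - g x'‖ ≤ C * |x - x'|) (hgL : g L = 0)
    (hA : ∀ f : L2R, ⇑(A f) =ᵐ[volume] (Set.Ioc 0 L).indicator fun x => ⟪g x, f⟫_ℂ) (k : ℕ) :
    sVal A k ≤ C * L * √L / (k + 1) := by
  set δ : ℝ := L / (k + 1) with hδ
  have hδ0 : 0 < δ := by positivity
  have hkδ : (k + 1) * δ = L := by rw [hδ]; field_simp
  set I : ℕ → Set ℝ := fun i => Set.Ioc (i * δ) ((i + 1) * δ) with hI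
  set e : ℕ → L2R := fun i => indicatorConstLp 2 (measurableSet_Ioc (a := i * δ)
    (b := (i + 1) * δ)) (by simp) 1 with he
  set l : ℕ → L2R →L[ℂ] ℂ := fun i => innerSL ℂ (g ((i + 1) * δ)) with hl
  refine sVal_le_of_norm_sub_le (rank_range_sum_smulRight_le l e k) ?_
  refine ContinuousLinearMap.opNorm_le_bound _ (by positivity) fun f => ?_
  have hlk : l k = 0 := by simp only [hl, hkδ, hgL, map_zero]
  have hsum : (∑ i ∈ Finset.range k, (l i).smulRight (e i) : L2R →L[ℂ] L2R) f =
      ∑ i ∈ Finset.range (k + 1), l i f • e i := by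
    rw [Finset.sum_range_succ, hlk]
    simp
  rw [sub_apply, hsum]
  have key : ∀ᵐ x, ‖(A f - ∑ i ∈ Finset.range (k + 1), l i f • e i : L2R) x‖ ≤
      (Set.Ioc 0 L).indicator (fun _ => C * δ * ‖f‖) x := by
    have h1 : ∀ᵐ x, ∀ i, (l i f • e i : L2R) x = (I i).indicator (fun _ => l i f) x := by
      refine ae_all_iff.2 fun i => ?_
      filter_upwards [Lp.coeFn_smul (l i f) (e i), indicatorConstLp_coeFn (p := 2)
        (μ := (volume : Measure ℝ)) (c := (1 : ℂ)) (hs := measurableSet_Ioc (a := i * δ)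
        (b := (i + 1) * δ)) (hμs := by simp)] with x h2 h3
      rw [h2, Pi.smul_apply, h3]
      by_cases hx : x ∈ Set.Ioc (i * δ) ((i + 1) * δ) <;> simp [hI, hx]
    filter_upwards [hA f, Lp.coeFn_sub (A f) (∑ i ∈ Finset.range (k + 1), l i f • e i),
      coeFn_sum_L2R (fun i => l i f • e i) (k + 1), h1] with x h2 h3 h4 h5
    rw [h3, Pi.sub_apply, h2, h4]
    simp only [h5]
    by_cases hx : x ∈ Set.Ioc 0 L
    · obtain ⟨j, hj, hxj⟩ : ∃ j < k + 1, x ∈ I j := by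
        have hpos : 0 < ⌈x / δ⌉₊ := Nat.ceil_pos.2 (div_pos hx.1 hδ0)
        have hc1 : x / δ ≤ ⌈x / δ⌉₊ := Nat.le_ceil _
        have hc2 : (⌈x / δ⌉₊ : ℝ) < x / δ + 1 := Nat.ceil_lt_add_one (div_pos hx.1 hδ0).le
        have hc3 : ⌈x / δ⌉₊ ≤ k + 1 := by
          refine Nat.ceil_le.2 ?_
          rw [div_le_iff₀ hδ0]
          push_cast
          rw [hkδ]
          exact hx.2
        obtain ⟨m, hm⟩ := Nat.exists_eq_succ_of_ne_zero hpos.ne'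
        rw [hm] at hc1 hc2 hc3
        push_cast at hc1 hc2
        refine ⟨m, by omega, ?_, ?_⟩
        · rw [← lt_div_iff₀ hδ0]; linarith
        · rwa [← div_le_iff₀ hδ0]
      have huniq : ∀ i, x ∈ I i → i = j := by
        intro i hi
        have a1 := (mul_lt_mul_iff_left₀ hδ0).1 (hi.1.trans_le hxj.2)
        have a2 := (mul_lt_mul_iff_left₀ hδ0).1 (hxj.1.trans_le hi.2)
        have a3 : i < j + 1 := by exact_mod_cast a1
        have a4 : j < i + 1 := by exact_mod_cast a2
        omega
      rw [Finset.sum_eq_single j, Set.indicator_of_mem hx, Set.indicator_of_mem hx,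
        Set.indicator_of_mem hxj]
      · simp only [hl, innerSL_apply_apply]
        rw [← inner_sub_left]
        refine (norm_inner_le_norm _ _).trans (mul_le_mul_of_nonneg_right ?_ (norm_nonneg _))
        refine (hg _ _).trans (mul_le_mul_of_nonneg_left ?_ hC)
        have := hxj.1
        have := hxj.2
        rw [abs_le]
        constructor <;> linarith
      · intro i _ hij
        exact Set.indicator_of_notMem (fun h => hij (huniq i h)) _
      · intro h
        exact absurd (Finset.mem_range.2 hj) h
    · rw [Set.indicator_of_notMem hx, Set.indicator_of_notMem hx, Finset.sum_eq_zero]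
      · simp
      · intro i hi
        refine Set.indicator_of_notMem (fun h => hx ⟨?_, ?_⟩) _
        · exact lt_of_le_of_lt (by positivity) h.1
        · refine h.2.trans ?_
          rw [← hkδ]
          refine mul_le_mul_of_nonneg_right ?_ hδ0.le
          have := Finset.mem_range.1 hi
          exact_mod_cast this
  refine (norm_le_of_ae_le_indicator_Ioc (by positivity) hL.le key).trans (le_of_eq ?_)
  rw [sub_zero, hδ]
  ring

section QuarterPlane

variable {φ : ℝ × ℝ → ℝ} {M : ℝ}

lemma weylKernel_eq_zero (hM : ∀ p, φ p ≠ 0 → |p.1| ≤ M ∧ |p.2| ≤ M) {x y : ℝ}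
    (h : 2 * M < x + y) : weylKernel φ M x y = 0 := by
  unfold weylKernel
  have h0 : ∀ ξ, weylPhase φ x y ξ = 0 := by
    intro ξ
    have : φ ((x + y) / 2, ξ) = 0 := by
      by_contra h1
      have := (abs_le.1 (hM _ h1).1).2
      simp only at this
      linarith
    simp [weylPhase, this]
  simp [h0]

lemma weylIntegral_quarter_plane (hφ : Continuous φ)
    (hM : ∀ p, φ p ≠ 0 → |p.1| ≤ M ∧ |p.2| ≤ M) {u : ℝ → ℂ} (hu : Continuous u) (x : ℝ) :
    weylIntegral (symbAOm (sector (Real.pi / 2)) φ) u x =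
      ∫ y, (Set.Ioc (-x) (2 * M - x)).indicator (weylKernel φ M x) y * u y := by
  classical
  have hsymb : ∀ ξ y : ℝ, Complex.exp (Complex.I * ((x - y) * ξ : ℝ)) *
      symbAOm (sector (Real.pi / 2)) φ ((x + y) / 2, ξ) * u y =
      (Set.Ioi 0 ×ˢ Set.Ioi (-x)).indicator
        (fun p : ℝ × ℝ => weylPhase φ x p.2 p.1 * u p.2) (ξ, y) := by
    intro ξ y
    have : (0 < (x + y) / 2 ∧ 0 < ξ) ↔ (ξ, y) ∈ Set.Ioi (0 : ℝ) ×ˢ Set.Ioi (-x) := by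
      simp only [Set.mem_prod, Set.mem_Ioi]
      constructor <;> rintro ⟨h1, h2⟩ <;> constructor <;> linarith
    rw [symbAOm_quarter_plane, Set.indicator_apply]
    simp only [this]
    split_ifs <;> simp [weylPhase]
  have hcont : Continuous fun p : ℝ × ℝ => weylPhase φ x p.2 p.1 * u p.2 :=
    (continuous_weylPhase hφ x).mul (hu.comp continuous_snd)
  have hcomp : HasCompactSupport fun p : ℝ × ℝ => weylPhase φ x p.2 p.1 * u p.2 := by
    refine HasCompactSupport.intro
      ((isCompact_Icc (a := -M) (b := M)).prod
        (isCompact_Icc (a := -(2 * M) - x) (b := 2 * M - x))) fun p hp => ?_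
    have : φ ((x + p.2) / 2, p.1) = 0 := by
      by_contra h
      obtain ⟨h1, h2⟩ := hM _ h
      rw [abs_le] at h1 h2
      refine hp ⟨h2, ?_, ?_⟩ <;> linarith [h1.1, h1.2]
    simp [weylPhase, this]
  have hint : Integrable ((Set.Ioi (0 : ℝ) ×ˢ Set.Ioi (-x)).indicator
      (fun p : ℝ × ℝ => weylPhase φ x p.2 p.1 * u p.2)) (volume.prod volume) :=
    (hcont.integrable_of_hasCompactSupport hcomp).indicator
      (measurableSet_Ioi.prod measurableSet_Ioi)
  unfold weylIntegral
  simp only [hsymb]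
  rw [integral_integral_swap (by simpa [Function.uncurry_def] using hint), ← integral_const_mul]
  refine integral_congr_ae (Eventually.of_forall fun y => ?_)
  simp only
  by_cases hy : -x < y
  · have h1 : ∫ ξ, (Set.Ioi (0 : ℝ) ×ˢ Set.Ioi (-x)).indicator
        (fun p : ℝ × ℝ => weylPhase φ x p.2 p.1 * u p.2) (ξ, y) =
        ∫ ξ in Set.Ioc 0 M, weylPhase φ x y ξ * u y := by
      rw [← integral_indicator measurableSet_Ioc]
      refine integral_congr_ae (Eventually.of_forall fun ξ => ?_)
      simp only [Set.indicator_apply, Set.mem_prod, Set.mem_Ioi, hy, and_true, Set.mem_Ioc]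
      by_cases h2 : ξ ≤ M
      · simp [h2]
      · have : φ ((x + y) / 2, ξ) = 0 := by
          by_contra h
          exact h2 ((le_abs_self _).trans (hM _ h).2)
        simp [weylPhase, this]
    rw [h1, integral_mul_const, ← mul_assoc]
    by_cases h2 : y ≤ 2 * M - x
    · rw [Set.indicator_of_mem (show y ∈ Set.Ioc (-x) (2 * M - x) from ⟨hy, h2⟩)]
      rfl
    · rw [Set.indicator_of_notMem (fun h => h2 h.2)]
      have := weylKernel_eq_zero (x := x) (y := y) hM (by linarith)
      unfold weylKernel at this
      rw [this]
  · rw [Set.indicator_of_notMem (fun h => hy h.1)]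
    have : ∀ ξ, (Set.Ioi (0 : ℝ) ×ˢ Set.Ioi (-x)).indicator
        (fun p : ℝ × ℝ => weylPhase φ x p.2 p.1 * u p.2) (ξ, y) = 0 :=
      fun ξ => Set.indicator_of_notMem (fun h => hy h.2) _
    simp [this]

/-- A bounded operator acting on Schwartz functions as `u ↦ ∫ k(x, y) u(y) dy` does so on all of
`L²(ℝ)`, provided that `k(x, ·)` is square integrable for each `x`. -/
lemma ae_eq_inner_of_schwartz {T : L2R →L[ℂ] L2R} {G : ℝ → L2R}
    (h : ∀ u : SchwartzMap ℝ ℂ, ∀ f : L2R, (⇑f =ᵐ[volume] ⇑u) →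
      ⇑(T f) =ᵐ[volume] fun x => ⟪G x, f⟫_ℂ) (f : L2R) :
    ⇑(T f) =ᵐ[volume] fun x => ⟪G x, f⟫_ℂ := by
  have hd := SchwartzMap.denseRange_toLpCLM (E := ℝ) (F := ℂ) (p := 2)
    (μ := (volume : Measure ℝ)) (by simp)
  obtain ⟨v, hv, hlim⟩ := mem_closure_iff_seq_limit.1 (hd f)
  obtain ⟨ns, hns, hae⟩ := (tendstoInMeasure_of_tendsto_Lp
    ((T.continuous.tendsto f).comp hlim)).exists_seq_tendsto_ae
  have hvn : ∀ᵐ x, ∀ n, T (v n) x = ⟪G x, v n⟫_ℂ := by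
    refine ae_all_iff.2 fun n => ?_
    obtain ⟨u, hu⟩ := hv n
    refine h u (v n) ?_
    rw [← hu]
    exact u.coeFn_toLp 2 volume
  filter_upwards [hae, hvn] with x h1 h2
  refine tendsto_nhds_unique h1 ?_
  simp only [Function.comp_apply, h2]
  exact ((innerSL ℂ (G x)).continuous.tendsto f).comp (hlim.comp hns.tendsto_atTop)

end QuarterPlane

/-- **Lemma.** For the quarter plane `Ω = Ω_{π/2}` and real-valued `φ ∈ C_0^∞(ℝ²)`, the
operators `1_± Op^w(1_Ω φ) 1_±` belong to `S_{1,∞}`: their singular values are `O(k^{-1})`. -/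
theorem projections_weyl_quarter_plane_S1infty
    (φ : ℝ × ℝ → ℝ) (hφ_smooth : ContDiff ℝ (⊤ : ℕ∞) φ) (hφ_supp : HasCompactSupport φ)
    (T : L2R →L[ℂ] L2R) (hT : IsWeylOp (symbAOm (sector (Real.pi / 2)) φ) T)
    (Pp Pm : L2R →L[ℂ] L2R)
    (hPp : ∀ f : L2R, ⇑(Pp f) =ᵐ[volume] fun x => if 0 < x then f x else 0)
    (hPm : ∀ f : L2R, ⇑(Pm f) =ᵐ[volume] fun x => if x < 0 then f x else 0) :
    ∃ C : ℝ, ∀ k : ℕ,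
      sVal (Pp.comp (T.comp Pp)) k ≤ C / (k + 1) ∧
      sVal (Pm.comp (T.comp Pm)) k ≤ C / (k + 1) := by
  obtain ⟨M, hM0, hM⟩ : ∃ M : ℝ, 0 < M ∧ ∀ p, φ p ≠ 0 → |p.1| ≤ M ∧ |p.2| ≤ M := by
    obtain ⟨M, hM0, hM⟩ := hφ_supp.isBounded.exists_pos_norm_le
    refine ⟨M, hM0, fun p hp => ?_⟩
    have := hM p (subset_tsupport _ hp)
    rwa [Prod.norm_def, max_le_iff] at this
  obtain ⟨C, hC, hlip⟩ := exists_weylKernel_lipschitz hφ_smooth hφ_supp hM0.le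
  have hcont : ∀ x, Continuous (weylKernel φ M x) := fun x =>
    (LipschitzWith.of_dist_le_mul (K := C.toNNReal) fun y y' => by
      simpa [dist_eq_norm, hC] using hlip x y x y').continuous
  choose G _ hGi using fun x => exists_inner_eq_integral_Ioc (hcont x) (-x) (2 * M - x)
  choose g hg hgi using fun x => exists_inner_eq_integral_Ioc (hcont x) 0 (2 * M)
  have hTG : ∀ f, ⇑(T f) =ᵐ[volume] fun x => ⟪G x, f⟫_ℂ := by
    refine ae_eq_inner_of_schwartz fun u f hf => ?_
    filter_upwards [hT u f hf] with x hx
    rw [hx, weylIntegral_quarter_plane hφ_smooth.continuous hM u.continuous, hGi]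
    refine integral_congr_ae ?_
    filter_upwards [hf] with y hy
    rw [hy]
  have hm : Pm.comp (T.comp Pm) = 0 := by
    ext1 f
    refine Lp.ext ?_
    filter_upwards [hPm (T (Pm f)), hTG (Pm f), Lp.coeFn_zero ℂ 2 (volume : Measure ℝ)]
      with x h1 h2 h3
    rw [zero_apply, h3]
    refine h1.trans ?_
    split_ifs with hx
    · rw [h2, hGi]
      refine integral_eq_zero_of_ae ?_
      filter_upwards [hPm f] with y hy
      rw [hy]
      by_cases hy0 : y < 0
      · rw [Set.indicator_of_notMem (fun h => by linarith [h.1])]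
        simp
      · simp [hy0]
    · rfl
  have hp : ∀ f, ⇑(Pp.comp (T.comp Pp) f) =ᵐ[volume]
      (Set.Ioc 0 (2 * M)).indicator fun x => ⟪g x, f⟫_ℂ := by
    intro f
    filter_upwards [hPp (T (Pp f)), hTG (Pp f)] with x h1 h2
    refine h1.trans ?_
    split_ifs with hx
    · have h3 : T (Pp f) x = ⟪g x, f⟫_ℂ := by
        rw [h2, hGi, hgi]
        refine integral_congr_ae ?_
        filter_upwards [hPp f] with y hy
        rw [hy]
        by_cases hy0 : 0 < y
        · by_cases hxy : 2 * M < x + y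
          · simp [Set.indicator_apply, weylKernel_eq_zero hM hxy]
          · have hy1 : y ∈ Set.Ioc (-x) (2 * M - x) := ⟨by linarith, by linarith⟩
            have hy2 : y ∈ Set.Ioc 0 (2 * M) := ⟨hy0, by linarith⟩
            rw [Set.indicator_of_mem hy1, Set.indicator_of_mem hy2, if_pos hy0]
        · rw [Set.indicator_of_notMem (s := Set.Ioc 0 (2 * M)) (fun h => hy0 h.1)]
          simp [hy0]
      by_cases hxM : x ≤ 2 * M
      · rw [Set.indicator_of_mem (show x ∈ Set.Ioc 0 (2 * M) from ⟨hx, hxM⟩), h3]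
      · rw [Set.indicator_of_notMem (fun h => hxM h.2), h3, hgi]
        refine integral_eq_zero_of_ae (Eventually.of_forall fun y => ?_)
        by_cases hy : y ∈ Set.Ioc 0 (2 * M)
        · simp [Set.indicator_of_mem hy,
            weylKernel_eq_zero (x := x) (y := y) hM (by linarith [hy.1])]
        · simp [Set.indicator_of_notMem hy]
    · rw [Set.indicator_of_notMem (fun h => hx h.1)]
  have hglip : ∀ x x', ‖g x - g x'‖ ≤ C * √(2 * M) * |x - x'| := by
    intro x x'
    have := norm_le_of_ae_le_indicator_Ioc (f := g x - g x') (c := C * |x - x'|) (a := 0)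
      (b := 2 * M) (by positivity) (by positivity) ?_
    · refine this.trans (le_of_eq ?_)
      rw [sub_zero]
      ring
    · filter_upwards [Lp.coeFn_sub (g x) (g x'), hg x, hg x'] with y h1 h2 h3
      rw [h1, Pi.sub_apply, h2, h3]
      by_cases hy : y ∈ Set.Ioc 0 (2 * M)
      · simp only [Set.indicator_of_mem hy]
        rw [← map_sub, RCLike.norm_conj]
        simpa using hlip x y x' y
      · simp [Set.indicator_of_notMem hy]
  have hgL : g (2 * M) = 0 := by
    refine Lp.ext ?_
    filter_upwards [hg (2 * M), Lp.coeFn_zero ℂ 2 (volume : Measure ℝ)] with y h1 h2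
    rw [h1, h2]
    by_cases hy : y ∈ Set.Ioc 0 (2 * M)
    · simp [Set.indicator_of_mem hy,
        weylKernel_eq_zero (x := 2 * M) (y := y) hM (by linarith [hy.1])]
    · simp [Set.indicator_of_notMem hy]
  refine ⟨C * √(2 * M) * (2 * M) * √(2 * M), fun k => ⟨?_, ?_⟩⟩
  · exact sVal_le_of_lipschitz_inner (by positivity) (by positivity) hglip hgL hp k
  · refine sVal_le_of_norm_sub_le (F := 0) (by simp) ?_
    rw [hm, sub_zero, norm_zero]
    positivity

end
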